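/- Suppose that for some N ≥ 1 the Riccati equation (ODE-P) has a solution 𝐏 on [0, T]. Then, writing 𝐏(t) = (P_{ij}(t))_{1≤i,j≤N} in n×n blocks, there exist symmetric matrix functions Π₁^N(t), Π₂^N(t) ∈ ℝ^{n×n} such that for every t ∈ [0,T], P_{ii}(t) = Π₁^N(t) for all 1 ≤ i ≤ N and P_{ij}(t) = Π₂^N(t) for all 1 ≤ i ≠ j ≤ N. -/

import Mathlib

open Matrix Set

namespace LQ

/-- Frobenius norm of a real matrix. -/
noncomputable def frob {a b : Type*} [Fintype a] [Fintype b] (M : Matrix a b ℝ) : ℝ :=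
  Real.sqrt (∑ i, ∑ j, (M i j) ^ 2)

/-- Entrywise ℓ₁ norm of a real matrix. -/
noncomputable def l1norm {a b : Type*} [Fintype a] [Fintype b] (M : Matrix a b ℝ) : ℝ :=
  ∑ i, ∑ j, |M i j|

/-- Block matrix with all diagonal m×m blocks equal to `F` and all off-diagonal blocks equal to `K`. -/
def blockConst (N m : ℕ) (F K : Matrix (Fin m) (Fin m) ℝ) :
    Matrix (Fin N × Fin m) (Fin N × Fin m) ℝ :=
  Matrix.of fun x y => if x.1 = y.1 then F x.2 y.2 else K x.2 y.2

/-- Block matrix with diagonal blocks `Λ₁` and off-diagonal blocks `Λ₂ / N`. -/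
noncomputable def blockPN (N n : ℕ) (Λ₁ Λ₂ : Matrix (Fin n) (Fin n) ℝ) :
    Matrix (Fin N × Fin n) (Fin N × Fin n) ℝ :=
  Matrix.of fun x y => if x.1 = y.1 then Λ₁ x.2 y.2 else Λ₂ x.2 y.2 / (N : ℝ)

/-- The permutation matrix exchanging the i-th and j-th block rows of `I_{Nn}`. -/
def Jswap (N n : ℕ) (i j : Fin N) : Matrix (Fin N × Fin n) (Fin N × Fin n) ℝ :=
  Matrix.of fun x y => if y.1 = Equiv.swap i j x.1 ∧ y.2 = x.2 then 1 else 0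

/-- `I_N ⊗ M`. -/
def kronIN (N : ℕ) {a b : ℕ} (M : Matrix (Fin a) (Fin b) ℝ) :
    Matrix (Fin N × Fin a) (Fin N × Fin b) ℝ :=
  Matrix.of fun x y => if x.1 = y.1 then M x.2 y.2 else 0

/-- `𝟏_{N×1} ⊗ M`. -/
def stackN (N : ℕ) {a b : ℕ} (M : Matrix (Fin a) (Fin b) ℝ) :
    Matrix (Fin N × Fin a) (Fin b) ℝ :=
  Matrix.of fun x y => M x.2 y

/-- Data of the LQ mean field social optimization problem. -/
structure Params (n n₁ : ℕ) where
  A : Matrix (Fin n) (Fin n) ℝ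
  G : Matrix (Fin n) (Fin n) ℝ
  Γ : Matrix (Fin n) (Fin n) ℝ
  Γf : Matrix (Fin n) (Fin n) ℝ
  B : Matrix (Fin n) (Fin n₁) ℝ
  B0 : Matrix (Fin n) (Fin n₁) ℝ
  B1 : Matrix (Fin n) (Fin n₁) ℝ
  D : Matrix (Fin n) (Fin 1) ℝ
  D0 : Matrix (Fin n) (Fin 1) ℝ
  Q : Matrix (Fin n) (Fin n) ℝ
  Qf : Matrix (Fin n) (Fin n) ℝ
  R : Matrix (Fin n₁) (Fin n₁) ℝ
  T : ℝ

namespace Params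

variable {n n₁ : ℕ} (p : Params n n₁)

/-- Standing hypotheses: positive dimensions, positive horizon, symmetric weights. -/
def Standing : Prop :=
  1 ≤ n ∧ 1 ≤ n₁ ∧ 0 < p.T ∧ p.Q.IsSymm ∧ p.Qf.IsSymm ∧ p.R.IsSymm

/-- Q^Γ = Γᵀ Q Γ − Q Γ − Γᵀ Q. -/
def QΓ : Matrix (Fin n) (Fin n) ℝ := p.Γᵀ * p.Q * p.Γ - p.Q * p.Γ - p.Γᵀ * p.Q

/-- Q_f^Γ = Γ_fᵀ Q_f Γ_f − Q_f Γ_f − Γ_fᵀ Q_f. -/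
def QfΓ : Matrix (Fin n) (Fin n) ℝ := p.Γfᵀ * p.Qf * p.Γf - p.Qf * p.Γf - p.Γfᵀ * p.Qf

/-- ℛ₁(Λ₁) = R + B₁ᵀ Λ₁ B₁. -/
def R1 (Λ₁ : Matrix (Fin n) (Fin n) ℝ) : Matrix (Fin n₁) (Fin n₁) ℝ :=
  p.R + p.B1ᵀ * Λ₁ * p.B1

/-- ℛ₂(Λ₁,Λ₂) = R + B₁ᵀ Λ₁ B₁ + B₀ᵀ(Λ₁+Λ₂)B₀. -/
def R2 (Λ₁ Λ₂ : Matrix (Fin n) (Fin n) ℝ) : Matrix (Fin n₁) (Fin n₁) ℝ :=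
  p.R + p.B1ᵀ * Λ₁ * p.B1 + p.B0ᵀ * (Λ₁ + Λ₂) * p.B0

/-- Ψ₁. -/
noncomputable def Ψ₁ (Λ₁ : Matrix (Fin n) (Fin n) ℝ) : Matrix (Fin n) (Fin n) ℝ :=
  Λ₁ * p.B * (p.R1 Λ₁)⁻¹ * p.Bᵀ * Λ₁ - Λ₁ * p.A - p.Aᵀ * Λ₁ - p.Q

/-- Ψ₂. -/
noncomputable def Ψ₂ (Λ₁ Λ₂ : Matrix (Fin n) (Fin n) ℝ) : Matrix (Fin n) (Fin n) ℝ :=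
  (Λ₁ + Λ₂) * p.B * (p.R2 Λ₁ Λ₂)⁻¹ * p.Bᵀ * (Λ₁ + Λ₂)
    - Λ₁ * p.B * (p.R1 Λ₁)⁻¹ * p.Bᵀ * Λ₁
    - (Λ₁ * p.G + Λ₂ * (p.A + p.G))
    - (p.Gᵀ * Λ₁ + (p.Aᵀ + p.Gᵀ) * Λ₂)
    - p.QΓ

/-- Solution of the limiting ODE system (ODE-Λ) on [0,T]. -/
noncomputable def IsSolLim (Λ₁ Λ₂ : ℝ → Matrix (Fin n) (Fin n) ℝ) : Prop :=
  (∀ t ∈ Icc (0 : ℝ) p.T, (Λ₁ t).IsSymm ∧ (Λ₂ t).IsSymm) ∧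
  (∀ t ∈ Icc (0 : ℝ) p.T, (p.R1 (Λ₁ t)).PosDef ∧ (p.R2 (Λ₁ t) (Λ₂ t)).PosDef) ∧
  Λ₁ p.T = p.Qf ∧ Λ₂ p.T = p.QfΓ ∧
  (∀ t ∈ Icc (0 : ℝ) p.T, ∀ i j, HasDerivWithinAt (fun s => Λ₁ s i j)
    (p.Ψ₁ (Λ₁ t) i j) (Icc (0 : ℝ) p.T) t) ∧
  (∀ t ∈ Icc (0 : ℝ) p.T, ∀ i j, HasDerivWithinAt (fun s => Λ₂ s i j)
    (p.Ψ₂ (Λ₁ t) (Λ₂ t) i j) (Icc (0 : ℝ) p.T) t)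

/-! Big (N-agent) matrices. -/

noncomputable def bigA (N : ℕ) : Matrix (Fin N × Fin n) (Fin N × Fin n) ℝ :=
  Matrix.of fun x y => (if x.1 = y.1 then p.A x.2 y.2 else 0) + p.G x.2 y.2 / (N : ℝ)

def bigBhat (N : ℕ) : Matrix (Fin N × Fin n) (Fin N × Fin n₁) ℝ :=
  Matrix.of fun x y => if x.1 = y.1 then p.B x.2 y.2 else 0

def bigB (N : ℕ) (i : Fin N) : Matrix (Fin N × Fin n) (Fin n₁) ℝ :=
  Matrix.of fun x l => if x.1 = i then p.B1 x.2 l else 0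

noncomputable def bigB0 (N : ℕ) : Matrix (Fin N × Fin n) (Fin n₁) ℝ :=
  Matrix.of fun x l => p.B0 x.2 l / (N : ℝ)

def bigD (N : ℕ) (i : Fin N) : Matrix (Fin N × Fin n) (Fin 1) ℝ :=
  Matrix.of fun x l => if x.1 = i then p.D x.2 l else 0

def bigD0 (N : ℕ) : Matrix (Fin N × Fin n) (Fin 1) ℝ :=
  Matrix.of fun x l => p.D0 x.2 l

def bigE (_p : Params n n₁) (N : ℕ) (i : Fin N) : Matrix (Fin n₁) (Fin N × Fin n₁) ℝ :=
  Matrix.of fun k y => if y.1 = i ∧ y.2 = k then 1 else 0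

def bigIhat (_p : Params n n₁) (N : ℕ) : Matrix (Fin n₁) (Fin N × Fin n₁) ℝ :=
  Matrix.of fun k y => if y.2 = k then 1 else 0

noncomputable def bigQ (N : ℕ) : Matrix (Fin N × Fin n) (Fin N × Fin n) ℝ :=
  Matrix.of fun x y => (if x.1 = y.1 then p.Q x.2 y.2 else 0) + p.QΓ x.2 y.2 / (N : ℝ)

noncomputable def bigQf (N : ℕ) : Matrix (Fin N × Fin n) (Fin N × Fin n) ℝ :=
  Matrix.of fun x y => (if x.1 = y.1 then p.Qf x.2 y.2 else 0) + p.QfΓ x.2 y.2 / (N : ℝ)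

def bigR (N : ℕ) : Matrix (Fin N × Fin n₁) (Fin N × Fin n₁) ℝ :=
  Matrix.of fun x y => if x.1 = y.1 then p.R x.2 y.2 else 0

/-- 𝓜₀. -/
noncomputable def M0 (N : ℕ) (Z : Matrix (Fin N × Fin n) (Fin N × Fin n) ℝ) :
    Matrix (Fin 1) (Fin 1) ℝ :=
  (1 / 2 : ℝ) • (∑ i : Fin N, (p.bigD N i)ᵀ * Z * p.bigD N i)
    + (1 / 2 : ℝ) • ((p.bigD0 N)ᵀ * Z * p.bigD0 N)

/-- 𝓜₁. -/
noncomputable def M1 (N : ℕ) (Z : Matrix (Fin N × Fin n) (Fin N × Fin n) ℝ) :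
    Matrix (Fin 1) (Fin N × Fin n₁) ℝ :=
  (∑ i : Fin N, (p.bigD N i)ᵀ * Z * p.bigB N i * p.bigE N i)
    + (p.bigD0 N)ᵀ * Z * p.bigB0 N * p.bigIhat N

/-- 𝓜₂. -/
noncomputable def M2 (N : ℕ) (Z : Matrix (Fin N × Fin n) (Fin N × Fin n) ℝ) :
    Matrix (Fin N × Fin n₁) (Fin N × Fin n₁) ℝ :=
  (1 / 2 : ℝ) • (∑ i : Fin N, (p.bigE N i)ᵀ * (p.bigB N i)ᵀ * Z * p.bigB N i * p.bigE N i)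
    + (1 / 2 : ℝ) • ((p.bigIhat N)ᵀ * (p.bigB0 N)ᵀ * Z * p.bigB0 N * p.bigIhat N)

/-- Right-hand side of the Riccati equation (ODE-P). -/
noncomputable def PRic (N : ℕ) (P : Matrix (Fin N × Fin n) (Fin N × Fin n) ℝ) :
    Matrix (Fin N × Fin n) (Fin N × Fin n) ℝ :=
  P * p.bigBhat N * (p.bigR N + (2 : ℝ) • p.M2 N P)⁻¹ * (p.bigBhat N)ᵀ * P
    - P * p.bigA N - (p.bigA N)ᵀ * P - p.bigQ N

/-- Solution of the large-scale Riccati equation (ODE-P) on [0,T]. -/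
noncomputable def IsSolP (N : ℕ) (P : ℝ → Matrix (Fin N × Fin n) (Fin N × Fin n) ℝ) : Prop :=
  (∀ t ∈ Icc (0 : ℝ) p.T, (P t).IsSymm) ∧
  (∀ t ∈ Icc (0 : ℝ) p.T, (p.bigR N + (2 : ℝ) • p.M2 N (P t)).PosDef) ∧
  P p.T = p.bigQf N ∧
  (∀ t ∈ Icc (0 : ℝ) p.T, ∀ x y, HasDerivWithinAt (fun s => P s x y)
    (p.PRic N (P t) x y) (Icc (0 : ℝ) p.T) t)

/-- Solution of the companion linear equation (ODE-S) on [0,T], relative to `P`. -/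
noncomputable def IsSolS (N : ℕ) (P : ℝ → Matrix (Fin N × Fin n) (Fin N × Fin n) ℝ)
    (S : ℝ → Matrix (Fin N × Fin n) (Fin 1) ℝ) : Prop :=
  S p.T = 0 ∧
  (∀ t ∈ Icc (0 : ℝ) p.T, ∀ x y, HasDerivWithinAt (fun s => S s x y)
    ((P t * p.bigBhat N * (p.bigR N + (2 : ℝ) • p.M2 N (P t))⁻¹ *
        ((p.bigBhat N)ᵀ * S t + (p.M1 N (P t))ᵀ) - (p.bigA N)ᵀ * S t) x y)
    (Icc (0 : ℝ) p.T) t)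

/-- Solution of the companion scalar equation (ODE-r) on [0,T], relative to `P` and `S`. -/
noncomputable def IsSolr (N : ℕ) (P : ℝ → Matrix (Fin N × Fin n) (Fin N × Fin n) ℝ)
    (S : ℝ → Matrix (Fin N × Fin n) (Fin 1) ℝ) (r : ℝ → ℝ) : Prop :=
  r p.T = 0 ∧
  (∀ t ∈ Icc (0 : ℝ) p.T, HasDerivWithinAt r
    (((((S t)ᵀ * p.bigBhat N + p.M1 N (P t)) * (p.bigR N + (2 : ℝ) • p.M2 N (P t))⁻¹ *
        ((p.bigBhat N)ᵀ * S t + (p.M1 N (P t))ᵀ)) - (2 : ℝ) • p.M0 N (P t)) 0 0)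
    (Icc (0 : ℝ) p.T) t)

/-- Asymptotic solvability of the LQ mean field social optimization problem. -/
noncomputable def AsympSolvable : Prop :=
  ∃ N₀ : ℕ, 1 ≤ N₀ ∧ ∃ c₀ : ℝ, 0 < c₀ ∧ ∃ C : ℝ,
    ∀ N : ℕ, N₀ ≤ N →
      ∃ P : ℝ → Matrix (Fin N × Fin n) (Fin N × Fin n) ℝ,
        p.IsSolP N P ∧
        (∀ t ∈ Icc (0 : ℝ) p.T, l1norm (P t) / (N : ℝ) ≤ C) ∧
        (∀ t ∈ Icc (0 : ℝ) p.T,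
          (p.bigR N + (2 : ℝ) • p.M2 N (P t) - c₀ • 1).PosSemidef)

/-! The rescaled low-dimensional system. -/

/-- E^N. -/
noncomputable def EN (N : ℕ) (Λ₁ Λ₂ : Matrix (Fin n) (Fin n) ℝ) :
    Matrix (Fin n₁) (Fin n₁) ℝ :=
  (1 / (N : ℝ)) •
    ((p.R2 Λ₁ Λ₂ - (1 / (N : ℝ)) • (p.B0ᵀ * Λ₂ * p.B0))⁻¹ - (p.R1 Λ₁)⁻¹)

/-- H^N. -/
noncomputable def HN (N : ℕ) (Λ₁ Λ₂ : Matrix (Fin n) (Fin n) ℝ) :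
    Matrix (Fin n₁) (Fin n₁) ℝ :=
  p.EN N Λ₁ Λ₂ + (p.R1 Λ₁)⁻¹

/-- g₁. -/
noncomputable def g₁ (N : ℕ) (Λ₁ Λ₂ : Matrix (Fin n) (Fin n) ℝ) :
    Matrix (Fin n) (Fin n) ℝ :=
  Λ₁ * p.B * p.EN N Λ₁ Λ₂ * p.Bᵀ * Λ₁
  + (1 - 1 / (N : ℝ)) •
      (Λ₂ * p.B * p.EN N Λ₁ Λ₂ * p.Bᵀ * Λ₁ + Λ₁ * p.B * p.EN N Λ₁ Λ₂ * p.Bᵀ * Λ₂)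
  + (1 / (N : ℝ) - 1 / (N : ℝ) ^ 2) •
      (Λ₂ * p.B * (p.HN N Λ₁ Λ₂ + ((N : ℝ) - 2) • p.EN N Λ₁ Λ₂) * p.Bᵀ * Λ₂)
  - (1 / (N : ℝ)) •
      ((Λ₁ * p.G + p.Gᵀ * Λ₁) + (1 - 1 / (N : ℝ)) • (Λ₂ * p.G + p.Gᵀ * Λ₂))
  - (1 / (N : ℝ)) • p.QΓ

/-- g₂. -/
noncomputable def g₂ (N : ℕ) (Λ₁ Λ₂ : Matrix (Fin n) (Fin n) ℝ) :
    Matrix (Fin n) (Fin n) ℝ :=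
  (Λ₁ + Λ₂) * p.B *
      ((N : ℝ) • p.EN N Λ₁ Λ₂ + (p.R1 Λ₁)⁻¹ - (p.R2 Λ₁ Λ₂)⁻¹) * p.Bᵀ * (Λ₁ + Λ₂)
  - (2 / (N : ℝ)) • (Λ₂ * p.B * (p.R1 Λ₁)⁻¹ * p.Bᵀ * Λ₂)
  + (1 / (N : ℝ) - 2) • (Λ₂ * p.B * p.EN N Λ₁ Λ₂ * p.Bᵀ * Λ₂)
  - Λ₁ * p.B * p.EN N Λ₁ Λ₂ * p.Bᵀ * Λ₂
  - Λ₂ * p.B * p.EN N Λ₁ Λ₂ * p.Bᵀ * Λ₁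
  + (1 / (N : ℝ)) • (Λ₂ * p.G + p.Gᵀ * Λ₂)

/-- Solution of the rescaled system (ODE-Λ^N) on [0,T]. -/
noncomputable def IsSolLamN (N : ℕ) (Λ₁ Λ₂ : ℝ → Matrix (Fin n) (Fin n) ℝ) : Prop :=
  (∀ t ∈ Icc (0 : ℝ) p.T, (Λ₁ t).IsSymm ∧ (Λ₂ t).IsSymm) ∧
  (∀ t ∈ Icc (0 : ℝ) p.T, (p.R1 (Λ₁ t)).PosDef ∧ (p.R2 (Λ₁ t) (Λ₂ t)).PosDef ∧
    (p.R2 (Λ₁ t) (Λ₂ t) - (1 / (N : ℝ)) • (p.B0ᵀ * Λ₂ t * p.B0)).PosDef) ∧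
  Λ₁ p.T = p.Qf + (1 / (N : ℝ)) • p.QfΓ ∧ Λ₂ p.T = p.QfΓ ∧
  (∀ t ∈ Icc (0 : ℝ) p.T, ∀ i j, HasDerivWithinAt (fun s => Λ₁ s i j)
    ((p.Ψ₁ (Λ₁ t) + p.g₁ N (Λ₁ t) (Λ₂ t)) i j) (Icc (0 : ℝ) p.T) t) ∧
  (∀ t ∈ Icc (0 : ℝ) p.T, ∀ i j, HasDerivWithinAt (fun s => Λ₂ s i j)
    ((p.Ψ₂ (Λ₁ t) (Λ₂ t) + p.g₂ N (Λ₁ t) (Λ₂ t)) i j) (Icc (0 : ℝ) p.T) t)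

/-! Companion (mean-field) equations. -/

/-- φ₁. -/
noncomputable def φ₁ (Λ₁ Λ₂ : Matrix (Fin n) (Fin n) ℝ) (S : Matrix (Fin n) (Fin 1) ℝ) :
    Matrix (Fin n) (Fin 1) ℝ :=
  (Λ₁ + Λ₂) * p.B * (p.R2 Λ₁ Λ₂)⁻¹ *
      (p.Bᵀ * S + p.B1ᵀ * Λ₁ * p.D + p.B0ᵀ * (Λ₁ + Λ₂) * p.D0)
    - (p.A + p.G)ᵀ * S

/-- φ₂. -/
noncomputable def φ₂ (Λ₁ Λ₂ : Matrix (Fin n) (Fin n) ℝ) (S : Matrix (Fin n) (Fin 1) ℝ) :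
    Matrix (Fin 1) (Fin 1) ℝ :=
  (Sᵀ * p.B + p.Dᵀ * Λ₁ * p.B1 + p.D0ᵀ * (Λ₁ + Λ₂) * p.B0) * (p.R2 Λ₁ Λ₂)⁻¹ *
      (p.Bᵀ * S + p.B1ᵀ * Λ₁ * p.D + p.B0ᵀ * (Λ₁ + Λ₂) * p.D0)
    - p.Dᵀ * Λ₁ * p.D - p.D0ᵀ * (Λ₁ + Λ₂) * p.D0

/-- Solution of the limiting companion system (ODE-Sr) on [0,T]. -/
noncomputable def IsSolSr (Λ₁ Λ₂ : ℝ → Matrix (Fin n) (Fin n) ℝ)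
    (S : ℝ → Matrix (Fin n) (Fin 1) ℝ) (r : ℝ → ℝ) : Prop :=
  S p.T = 0 ∧ r p.T = 0 ∧
  (∀ t ∈ Icc (0 : ℝ) p.T, ∀ i j, HasDerivWithinAt (fun s => S s i j)
    (p.φ₁ (Λ₁ t) (Λ₂ t) (S t) i j) (Icc (0 : ℝ) p.T) t) ∧
  (∀ t ∈ Icc (0 : ℝ) p.T, HasDerivWithinAt r
    ((p.φ₂ (Λ₁ t) (Λ₂ t) (S t)) 0 0) (Icc (0 : ℝ) p.T) t)

/-- g₀₁. -/
noncomputable def g01 (N : ℕ) (Λ₁ Λ₂ : Matrix (Fin n) (Fin n) ℝ)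
    (S : Matrix (Fin n) (Fin 1) ℝ) : Matrix (Fin n) (Fin 1) ℝ :=
  (Λ₁ + (1 - 1 / (N : ℝ)) • Λ₂) * p.B *
      (p.R2 Λ₁ Λ₂ - (1 / (N : ℝ)) • (p.B0ᵀ * Λ₂ * p.B0))⁻¹ *
      (p.Bᵀ * S + p.B1ᵀ * Λ₁ * p.D + p.B0ᵀ * (Λ₁ + (1 - 1 / (N : ℝ)) • Λ₂) * p.D0)
  - (Λ₁ + Λ₂) * p.B * (p.R2 Λ₁ Λ₂)⁻¹ *
      (p.Bᵀ * S + p.B1ᵀ * Λ₁ * p.D + p.B0ᵀ * (Λ₁ + Λ₂) * p.D0)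

/-- g₀₂. -/
noncomputable def g02 (N : ℕ) (Λ₁ Λ₂ : Matrix (Fin n) (Fin n) ℝ)
    (S : Matrix (Fin n) (Fin 1) ℝ) : Matrix (Fin 1) (Fin 1) ℝ :=
  (Sᵀ * p.B + p.Dᵀ * Λ₁ * p.B1 + p.D0ᵀ * (Λ₁ + (1 - 1 / (N : ℝ)) • Λ₂) * p.B0) *
      (p.R2 Λ₁ Λ₂ - (1 / (N : ℝ)) • (p.B0ᵀ * Λ₂ * p.B0))⁻¹ *
      (p.Bᵀ * S + p.B1ᵀ * Λ₁ * p.D + p.B0ᵀ * (Λ₁ + (1 - 1 / (N : ℝ)) • Λ₂) * p.D0)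
  - (Sᵀ * p.B + p.Dᵀ * Λ₁ * p.B1 + p.D0ᵀ * (Λ₁ + Λ₂) * p.B0) * (p.R2 Λ₁ Λ₂)⁻¹ *
      (p.Bᵀ * S + p.B1ᵀ * Λ₁ * p.D + p.B0ᵀ * (Λ₁ + Λ₂) * p.D0)
  + (1 / (N : ℝ)) • (p.D0ᵀ * Λ₂ * p.D0)

/-- Solution of the rescaled companion system (ODE-S^N r^N) on [0,T]. -/
noncomputable def IsSolSrN (N : ℕ) (Λ₁ Λ₂ : ℝ → Matrix (Fin n) (Fin n) ℝ)
    (S : ℝ → Matrix (Fin n) (Fin 1) ℝ) (r : ℝ → ℝ) : Prop :=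
  S p.T = 0 ∧ r p.T = 0 ∧
  (∀ t ∈ Icc (0 : ℝ) p.T, ∀ i j, HasDerivWithinAt (fun s => S s i j)
    ((p.φ₁ (Λ₁ t) (Λ₂ t) (S t) + p.g01 N (Λ₁ t) (Λ₂ t) (S t)) i j) (Icc (0 : ℝ) p.T) t) ∧
  (∀ t ∈ Icc (0 : ℝ) p.T, HasDerivWithinAt r
    ((p.φ₂ (Λ₁ t) (Λ₂ t) (S t) + p.g02 N (Λ₁ t) (Λ₂ t) (S t)) 0 0) (Icc (0 : ℝ) p.T) t)

/-! Feedback gains. -/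

/-- Θ = ℛ₁(Λ₁)⁻¹ Bᵀ Λ₁. -/
noncomputable def Theta (Λ₁ : Matrix (Fin n) (Fin n) ℝ) : Matrix (Fin n₁) (Fin n) ℝ :=
  (p.R1 Λ₁)⁻¹ * p.Bᵀ * Λ₁

/-- Θ₁ = (H₁ − H)Bᵀ(Λ₁+Λ₂) + HBᵀΛ₂. -/
noncomputable def Theta1 (Λ₁ Λ₂ : Matrix (Fin n) (Fin n) ℝ) : Matrix (Fin n₁) (Fin n) ℝ :=
  ((p.R2 Λ₁ Λ₂)⁻¹ - (p.R1 Λ₁)⁻¹) * p.Bᵀ * (Λ₁ + Λ₂) + (p.R1 Λ₁)⁻¹ * p.Bᵀ * Λ₂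

/-- Θ₂ = H₁[BᵀS + B₁ᵀΛ₁D + B₀ᵀ(Λ₁+Λ₂)D₀]. -/
noncomputable def Theta2 (Λ₁ Λ₂ : Matrix (Fin n) (Fin n) ℝ) (S : Matrix (Fin n) (Fin 1) ℝ) :
    Matrix (Fin n₁) (Fin 1) ℝ :=
  (p.R2 Λ₁ Λ₂)⁻¹ * (p.Bᵀ * S + p.B1ᵀ * Λ₁ * p.D + p.B0ᵀ * (Λ₁ + Λ₂) * p.D0)

/-- Θ^N. -/
noncomputable def ThetaN (N : ℕ) (Λ₁ Λ₂ : Matrix (Fin n) (Fin n) ℝ) :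
    Matrix (Fin n₁) (Fin n) ℝ :=
  (p.HN N Λ₁ Λ₂ - p.EN N Λ₁ Λ₂) * p.Bᵀ * (Λ₁ - (1 / (N : ℝ)) • Λ₂)

/-- Θ₁^N. -/
noncomputable def Theta1N (N : ℕ) (Λ₁ Λ₂ : Matrix (Fin n) (Fin n) ℝ) :
    Matrix (Fin n₁) (Fin n) ℝ :=
  (N : ℝ) • (p.EN N Λ₁ Λ₂ * p.Bᵀ * Λ₁)
    + (p.HN N Λ₁ Λ₂ + ((N : ℝ) - 2) • p.EN N Λ₁ Λ₂) * p.Bᵀ * Λ₂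

/-- Θ₂^N. -/
noncomputable def Theta2N (N : ℕ) (Λ₁ Λ₂ : Matrix (Fin n) (Fin n) ℝ)
    (S : Matrix (Fin n) (Fin 1) ℝ) : Matrix (Fin n₁) (Fin 1) ℝ :=
  (p.HN N Λ₁ Λ₂ + ((N : ℝ) - 1) • p.EN N Λ₁ Λ₂) *
    (p.Bᵀ * S + p.B1ᵀ * Λ₁ * p.D + p.B0ᵀ * (Λ₁ + (1 - 1 / (N : ℝ)) • Λ₂) * p.D0)

/-- Z₀ = −B₀(Θ + Θ₁). -/
noncomputable def Z0 (Λ₁ Λ₂ : Matrix (Fin n) (Fin n) ℝ) : Matrix (Fin n) (Fin n) ℝ :=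
  -(p.B0 * (p.Theta Λ₁ + p.Theta1 Λ₁ Λ₂))

/-- Z₁ = A + G − B(Θ + Θ₁). -/
noncomputable def Z1 (Λ₁ Λ₂ : Matrix (Fin n) (Fin n) ℝ) : Matrix (Fin n) (Fin n) ℝ :=
  p.A + p.G - p.B * (p.Theta Λ₁ + p.Theta1 Λ₁ Λ₂)

/-! The high-dimensional equations under the decentralized control. -/

/-- RHS of (ODE-P̌₁) (paper's −d𝐏̌₁/dt). -/
noncomputable def Pcheck1RHS (N : ℕ) (Θ : Matrix (Fin n₁) (Fin n) ℝ)
    (P1 : Matrix (Fin N × Fin n) (Fin N × Fin n) ℝ) :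
    Matrix (Fin N × Fin n) (Fin N × Fin n) ℝ :=
  (kronIN N Θ)ᵀ * (p.bigR N + p.M2 N ((2 : ℝ) • P1)) * kronIN N Θ
    + P1 * (p.bigA N - p.bigBhat N * kronIN N Θ)
    + (p.bigA N - p.bigBhat N * kronIN N Θ)ᵀ * P1
    + p.bigQ N

/-- Solution of (ODE-P̌₁) on [0,T], with Θ(t) built from Λ₁(t). -/
noncomputable def IsSolPcheck1 (N : ℕ) (Λ₁ : ℝ → Matrix (Fin n) (Fin n) ℝ)
    (P1 : ℝ → Matrix (Fin N × Fin n) (Fin N × Fin n) ℝ) : Prop :=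
  P1 p.T = p.bigQf N ∧
  (∀ t ∈ Icc (0 : ℝ) p.T, ∀ x y, HasDerivWithinAt (fun s => P1 s x y)
    ((-(p.Pcheck1RHS N (p.Theta (Λ₁ t)) (P1 t))) x y) (Icc (0 : ℝ) p.T) t)

/-- RHS of (ODE-P̌₁₂) (paper's −d𝐏̌₁₂/dt). -/
noncomputable def Pcheck12RHS (N : ℕ) (Λ₁m Λ₂m : Matrix (Fin n) (Fin n) ℝ)
    (P1 : Matrix (Fin N × Fin n) (Fin N × Fin n) ℝ)
    (P12 : Matrix (Fin N × Fin n) (Fin n) ℝ) :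
    Matrix (Fin N × Fin n) (Fin n) ℝ :=
  (kronIN N (p.Theta Λ₁m))ᵀ * (p.bigR N + p.M2 N ((2 : ℝ) • P1)) *
      stackN N (p.Theta1 Λ₁m Λ₂m)
    - P1 * p.bigBhat N * stackN N (p.Theta1 Λ₁m Λ₂m)
    + ((p.bigA N)ᵀ - (kronIN N (p.Theta Λ₁m))ᵀ * (p.bigBhat N)ᵀ) * P12
    + P12 * p.Z1 Λ₁m Λ₂m
    - (kronIN N (p.Theta Λ₁m))ᵀ * (p.bigIhat N)ᵀ * (p.bigB0 N)ᵀ * P12 * p.Z0 Λ₁m Λ₂m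

/-- Solution of (ODE-P̌₁₂) on [0,T]. -/
noncomputable def IsSolPcheck12 (N : ℕ) (Λ₁ Λ₂ : ℝ → Matrix (Fin n) (Fin n) ℝ)
    (P1 : ℝ → Matrix (Fin N × Fin n) (Fin N × Fin n) ℝ)
    (P12 : ℝ → Matrix (Fin N × Fin n) (Fin n) ℝ) : Prop :=
  P12 p.T = 0 ∧
  (∀ t ∈ Icc (0 : ℝ) p.T, ∀ x y, HasDerivWithinAt (fun s => P12 s x y)
    ((-(p.Pcheck12RHS N (Λ₁ t) (Λ₂ t) (P1 t) (P12 t))) x y) (Icc (0 : ℝ) p.T) t)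

/-! The decentralized-control low-dimensional coefficient system. -/

/-- ǧ₁. -/
noncomputable def gc1 (N : ℕ) (Θ : Matrix (Fin n₁) (Fin n) ℝ)
    (L1 L2 : Matrix (Fin n) (Fin n) ℝ) : Matrix (Fin n) (Fin n) ℝ :=
  (1 / (N : ℝ)) •
    (Θᵀ * p.B0ᵀ * (L1 + (1 - 1 / (N : ℝ)) • L2) * p.B0 * Θ
      + (L1 + (1 - 1 / (N : ℝ)) • L2) * p.G
      + p.Gᵀ * (L1 + (1 - 1 / (N : ℝ)) • L2)
      + p.QΓ)

/-- ǧ₂. -/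
noncomputable def gc2 (N : ℕ) (Θ : Matrix (Fin n₁) (Fin n) ℝ)
    (L2 : Matrix (Fin n) (Fin n) ℝ) : Matrix (Fin n) (Fin n) ℝ :=
  -((1 / (N : ℝ)) • (Θᵀ * p.B0ᵀ * L2 * p.B0 * Θ + L2 * p.G + p.Gᵀ * L2))

/-- ǧ₁₂. -/
noncomputable def gc12 (N : ℕ) (Θ Θ₁ : Matrix (Fin n₁) (Fin n) ℝ)
    (L2 : Matrix (Fin n) (Fin n) ℝ) : Matrix (Fin n) (Fin n) ℝ :=
  (1 / (N : ℝ)) • (-(Θᵀ * p.B0ᵀ * L2 * p.B0 * Θ₁) + L2 * p.B * Θ₁)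

/-- ǧ₂₂. -/
noncomputable def gc22 (N : ℕ) (Θ₁ : Matrix (Fin n₁) (Fin n) ℝ)
    (L2 : Matrix (Fin n) (Fin n) ℝ) : Matrix (Fin n) (Fin n) ℝ :=
  -((1 / (N : ℝ)) • (Θ₁ᵀ * p.B0ᵀ * L2 * p.B0 * Θ₁))

/-- ǧ₀₁. -/
noncomputable def gc01 (N : ℕ) (Θ : Matrix (Fin n₁) (Fin n) ℝ)
    (Θ₂ : Matrix (Fin n₁) (Fin 1) ℝ) (L2 : Matrix (Fin n) (Fin n) ℝ) :
    Matrix (Fin n) (Fin 1) ℝ :=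
  (1 / (N : ℝ)) • (Θᵀ * p.B0ᵀ * L2 * (p.D0 - p.B0 * Θ₂) + L2 * p.B * Θ₂)

/-- ǧ₀₂. -/
noncomputable def gc02 (N : ℕ) (Θ₁ : Matrix (Fin n₁) (Fin n) ℝ)
    (Θ₂ : Matrix (Fin n₁) (Fin 1) ℝ) (L2 : Matrix (Fin n) (Fin n) ℝ) :
    Matrix (Fin n) (Fin 1) ℝ :=
  (1 / (N : ℝ)) • (-(Θ₁ᵀ * p.B0ᵀ * L2 * p.B0 * Θ₂) + Θ₁ᵀ * p.B0ᵀ * L2 * p.D0)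

/-- RHS of (ODE-Λ̌₁^N) (paper's −dΛ̌₁^N/dt). -/
noncomputable def check1RHS (N : ℕ) (Θ : Matrix (Fin n₁) (Fin n) ℝ)
    (L1 L2 : Matrix (Fin n) (Fin n) ℝ) : Matrix (Fin n) (Fin n) ℝ :=
  Θᵀ * p.R1 L1 * Θ + L1 * (p.A - p.B * Θ) + (p.A - p.B * Θ)ᵀ * L1 + p.Q
    + p.gc1 N Θ L1 L2

/-- RHS of (ODE-Λ̌₂^N). -/
noncomputable def check2RHS (N : ℕ) (Θ : Matrix (Fin n₁) (Fin n) ℝ)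
    (L1 L2 : Matrix (Fin n) (Fin n) ℝ) : Matrix (Fin n) (Fin n) ℝ :=
  Θᵀ * p.B0ᵀ * (L1 + L2) * p.B0 * Θ + L1 * p.G + p.Gᵀ * L1
    + L2 * (p.A + p.G - p.B * Θ) + (p.A + p.G - p.B * Θ)ᵀ * L2 + p.QΓ
    + p.gc2 N Θ L2

/-- RHS of (ODE-Λ̌₁₂^N). -/
noncomputable def check12RHS (N : ℕ) (Θ Θ₁ : Matrix (Fin n₁) (Fin n) ℝ)
    (L1 L2 L12 : Matrix (Fin n) (Fin n) ℝ) : Matrix (Fin n) (Fin n) ℝ :=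
  Θᵀ * p.R2 L1 L2 * Θ₁ + Θᵀ * p.B0ᵀ * L12 * p.B0 * (Θ + Θ₁)
    - (L1 + L2) * p.B * Θ₁
    + (p.A + p.G - p.B * Θ)ᵀ * L12
    + L12 * (p.A + p.G - p.B * (Θ₁ + Θ))
    + p.gc12 N Θ Θ₁ L2

/-- RHS of (ODE-Λ̌₂₂^N). -/
noncomputable def check22RHS (N : ℕ) (Θ₁ : Matrix (Fin n₁) (Fin n) ℝ)
    (Z₀ Z₁ : Matrix (Fin n) (Fin n) ℝ)
    (L1 L2 L12 L22 : Matrix (Fin n) (Fin n) ℝ) : Matrix (Fin n) (Fin n) ℝ :=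
  Θ₁ᵀ * p.R2 L1 L2 * Θ₁ - L12ᵀ * p.B * Θ₁ - Θ₁ᵀ * p.Bᵀ * L12
    + L22 * Z₁ + Z₁ᵀ * L22
    - Z₀ᵀ * L12ᵀ * p.B0 * Θ₁ - Θ₁ᵀ * p.B0ᵀ * L12 * Z₀
    + Z₀ᵀ * L22 * Z₀ + p.gc22 N Θ₁ L2

/-- RHS of (ODE-Š₁^N). -/
noncomputable def checkS1RHS (N : ℕ) (Θ : Matrix (Fin n₁) (Fin n) ℝ)
    (Θ₂ : Matrix (Fin n₁) (Fin 1) ℝ) (L1 L2 L12 : Matrix (Fin n) (Fin n) ℝ)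
    (S1 : Matrix (Fin n) (Fin 1) ℝ) : Matrix (Fin n) (Fin 1) ℝ :=
  Θᵀ * p.R2 L1 L2 * Θ₂ - (L1 + L2 + L12) * p.B * Θ₂
    - Θᵀ * (p.Bᵀ * S1 + p.B1ᵀ * L1 * p.D + p.B0ᵀ * (L1 + L2) * p.D0)
    - Θᵀ * p.B0ᵀ * L12 * (p.D0 - p.B0 * Θ₂)
    + (p.A + p.G)ᵀ * S1
    + p.gc01 N Θ Θ₂ L2

/-- RHS of (ODE-Š₂^N). -/
noncomputable def checkS2RHS (N : ℕ) (Θ₁ : Matrix (Fin n₁) (Fin n) ℝ)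
    (Θ₂ : Matrix (Fin n₁) (Fin 1) ℝ) (Z₀ Z₁ : Matrix (Fin n) (Fin n) ℝ)
    (L1 L2 L12 L22 : Matrix (Fin n) (Fin n) ℝ)
    (S1 S2 : Matrix (Fin n) (Fin 1) ℝ) : Matrix (Fin n) (Fin 1) ℝ :=
  Θ₁ᵀ * p.R2 L1 L2 * Θ₂ + Z₁ᵀ * S2
    - Θ₁ᵀ * (p.Bᵀ * S1 + p.B1ᵀ * L1 * p.D + p.B0ᵀ * (L1 + L2) * p.D0)
    + (Z₀ᵀ * L22 + Z₀ᵀ * L12ᵀ - Θ₁ᵀ * p.B0ᵀ * L12) * (p.D0 - p.B0 * Θ₂)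
    - (L12ᵀ + L22) * p.B * Θ₂
    + p.gc02 N Θ₁ Θ₂ L2

/-- Solution of the pair (ODE-Λ̌₁^N)–(ODE-Λ̌₂^N) on [0,T], with Θ(t) from the limiting Λ₁. -/
noncomputable def IsSolCheckA (N : ℕ) (Λ₁ : ℝ → Matrix (Fin n) (Fin n) ℝ)
    (L1 L2 : ℝ → Matrix (Fin n) (Fin n) ℝ) : Prop :=
  L1 p.T = p.Qf + (1 / (N : ℝ)) • p.QfΓ ∧ L2 p.T = p.QfΓ ∧
  (∀ t ∈ Icc (0 : ℝ) p.T, ∀ i j, HasDerivWithinAt (fun s => L1 s i j)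
    ((-(p.check1RHS N (p.Theta (Λ₁ t)) (L1 t) (L2 t))) i j) (Icc (0 : ℝ) p.T) t) ∧
  (∀ t ∈ Icc (0 : ℝ) p.T, ∀ i j, HasDerivWithinAt (fun s => L2 s i j)
    ((-(p.check2RHS N (p.Theta (Λ₁ t)) (L1 t) (L2 t))) i j) (Icc (0 : ℝ) p.T) t)

/-- Solution of (ODE-Λ̌₁^N)–(ODE-Λ̌₂₂^N) on [0,T], with Θ, Θ₁, Z₀, Z₁ from the limiting (Λ₁, Λ₂). -/
noncomputable def IsSolCheckB (N : ℕ) (Λ₁ Λ₂ : ℝ → Matrix (Fin n) (Fin n) ℝ)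
    (L1 L2 L12 L22 : ℝ → Matrix (Fin n) (Fin n) ℝ) : Prop :=
  p.IsSolCheckA N Λ₁ L1 L2 ∧
  L12 p.T = 0 ∧ L22 p.T = 0 ∧
  (∀ t ∈ Icc (0 : ℝ) p.T, ∀ i j, HasDerivWithinAt (fun s => L12 s i j)
    ((-(p.check12RHS N (p.Theta (Λ₁ t)) (p.Theta1 (Λ₁ t) (Λ₂ t))
        (L1 t) (L2 t) (L12 t))) i j) (Icc (0 : ℝ) p.T) t) ∧
  (∀ t ∈ Icc (0 : ℝ) p.T, ∀ i j, HasDerivWithinAt (fun s => L22 s i j)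
    ((-(p.check22RHS N (p.Theta1 (Λ₁ t) (Λ₂ t)) (p.Z0 (Λ₁ t) (Λ₂ t))
        (p.Z1 (Λ₁ t) (Λ₂ t)) (L1 t) (L2 t) (L12 t) (L22 t))) i j) (Icc (0 : ℝ) p.T) t)

/-- Solution of the full decentralized coefficient system on [0,T],
with Θ, Θ₁, Θ₂, Z₀, Z₁ from the limiting (Λ₁, Λ₂, S). -/
noncomputable def IsSolCheckC (N : ℕ) (Λ₁ Λ₂ : ℝ → Matrix (Fin n) (Fin n) ℝ)
    (S : ℝ → Matrix (Fin n) (Fin 1) ℝ)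
    (L1 L2 L12 L22 : ℝ → Matrix (Fin n) (Fin n) ℝ)
    (S1 S2 : ℝ → Matrix (Fin n) (Fin 1) ℝ) : Prop :=
  p.IsSolCheckB N Λ₁ Λ₂ L1 L2 L12 L22 ∧
  S1 p.T = 0 ∧ S2 p.T = 0 ∧
  (∀ t ∈ Icc (0 : ℝ) p.T, ∀ i j, HasDerivWithinAt (fun s => S1 s i j)
    ((-(p.checkS1RHS N (p.Theta (Λ₁ t)) (p.Theta2 (Λ₁ t) (Λ₂ t) (S t))
        (L1 t) (L2 t) (L12 t) (S1 t))) i j) (Icc (0 : ℝ) p.T) t) ∧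
  (∀ t ∈ Icc (0 : ℝ) p.T, ∀ i j, HasDerivWithinAt (fun s => S2 s i j)
    ((-(p.checkS2RHS N (p.Theta1 (Λ₁ t) (Λ₂ t)) (p.Theta2 (Λ₁ t) (Λ₂ t) (S t))
        (p.Z0 (Λ₁ t) (Λ₂ t)) (p.Z1 (Λ₁ t) (Λ₂ t))
        (L1 t) (L2 t) (L12 t) (L22 t) (S1 t) (S2 t))) i j) (Icc (0 : ℝ) p.T) t)

end Params

section Equivariance

variable {n n₁ : ℕ} (p : Params n n₁) {N : ℕ}

/-- The permutation of block indices induced by a permutation of agents. -/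
def blockPerm (m : ℕ) (σ : Equiv.Perm (Fin N)) : Equiv.Perm (Fin N × Fin m) :=
  σ.prodCongr (Equiv.refl (Fin m))

@[simp] lemma blockPerm_fst {m : ℕ} (σ : Equiv.Perm (Fin N)) (x : Fin N × Fin m) :
    (blockPerm m σ x).1 = σ x.1 := rfl

@[simp] lemma blockPerm_snd {m : ℕ} (σ : Equiv.Perm (Fin N)) (x : Fin N × Fin m) :
    (blockPerm m σ x).2 = x.2 := rfl

variable (σ : Equiv.Perm (Fin N))

lemma bigA_submatrix : (p.bigA N).submatrix (blockPerm n σ) (blockPerm n σ) = p.bigA N := by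
  ext x y; simp [Params.bigA]

lemma bigQ_submatrix : (p.bigQ N).submatrix (blockPerm n σ) (blockPerm n σ) = p.bigQ N := by
  ext x y; simp [Params.bigQ]

lemma bigQf_submatrix : (p.bigQf N).submatrix (blockPerm n σ) (blockPerm n σ) = p.bigQf N := by
  ext x y; simp [Params.bigQf]

lemma bigR_submatrix : (p.bigR N).submatrix (blockPerm n₁ σ) (blockPerm n₁ σ) = p.bigR N := by
  ext x y; simp [Params.bigR]

lemma bigBhat_submatrix :
    (p.bigBhat N).submatrix (blockPerm n σ) (blockPerm n₁ σ) = p.bigBhat N := by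
  ext x y; simp [Params.bigBhat]

lemma bigB_submatrix (i : Fin N) :
    (p.bigB N (σ i)).submatrix (blockPerm n σ) id = p.bigB N i := by
  ext x y; simp [Params.bigB]

lemma bigE_submatrix (i : Fin N) :
    (p.bigE N (σ i)).submatrix id (blockPerm n₁ σ) = p.bigE N i := by
  ext x y; simp [Params.bigE]

lemma bigB0_submatrix : (p.bigB0 N).submatrix (blockPerm n σ) id = p.bigB0 N := by
  ext x y; simp [Params.bigB0]

lemma bigIhat_submatrix : (p.bigIhat N).submatrix id (blockPerm n₁ σ) = p.bigIhat N :=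
  rfl

lemma sandwich_submatrix {a b c : Type*} [Fintype a] [Fintype b] [Fintype c]
    (e : Equiv.Perm a) (f : Equiv.Perm c) (Z : Matrix a a ℝ) (U : Matrix a b ℝ)
    (V : Matrix b c ℝ) :
    (V.submatrix id f)ᵀ * (U.submatrix e id)ᵀ * Z.submatrix e e * U.submatrix e id *
      V.submatrix id f = (Vᵀ * Uᵀ * Z * U * V).submatrix f f := by
  ext x y
  simp only [Matrix.transpose_submatrix, Matrix.submatrix_apply, Matrix.mul_apply,
    Matrix.transpose_apply, id]
  refine Finset.sum_congr rfl fun k _ => ?_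
  congr 1
  rw [← Equiv.sum_comp e (fun j => (∑ i, (∑ l, V l (f x) * U i l) * Z i j) * U j k)]
  refine Finset.sum_congr rfl fun j _ => ?_
  congr 1
  exact Equiv.sum_comp e (fun i => (∑ l, V l (f x) * U i l) * Z i (e j))

lemma M2_submatrix (Z : Matrix (Fin N × Fin n) (Fin N × Fin n) ℝ) :
    p.M2 N (Z.submatrix (blockPerm n σ) (blockPerm n σ)) =
      (p.M2 N Z).submatrix (blockPerm n₁ σ) (blockPerm n₁ σ) := by
  have h1 (i : Fin N) := sandwich_submatrix (blockPerm n σ) (blockPerm n₁ σ) Z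
    (p.bigB N (σ i)) (p.bigE N (σ i))
  have h2 := sandwich_submatrix (blockPerm n σ) (blockPerm n₁ σ) Z (p.bigB0 N) (p.bigIhat N)
  simp only [bigB_submatrix, bigE_submatrix, bigB0_submatrix, bigIhat_submatrix] at h1 h2
  unfold Params.M2
  rw [h2, Finset.sum_congr rfl fun i _ => h1 i]
  ext x y
  simp only [Matrix.add_apply, Matrix.smul_apply, Matrix.submatrix_apply, Matrix.sum_apply]
  rw [Equiv.sum_comp σ (fun i => ((p.bigE N i)ᵀ * (p.bigB N i)ᵀ * Z * p.bigB N i * p.bigE N i)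
    (blockPerm n₁ σ x) (blockPerm n₁ σ y))]

lemma weight_submatrix (Z : Matrix (Fin N × Fin n) (Fin N × Fin n) ℝ) :
    p.bigR N + (2 : ℝ) • p.M2 N (Z.submatrix (blockPerm n σ) (blockPerm n σ)) =
      (p.bigR N + (2 : ℝ) • p.M2 N Z).submatrix (blockPerm n₁ σ) (blockPerm n₁ σ) := by
  rw [M2_submatrix]
  conv_lhs => rw [← bigR_submatrix p σ]
  rfl

lemma PRic_submatrix (Z : Matrix (Fin N × Fin n) (Fin N × Fin n) ℝ) :
    p.PRic N (Z.submatrix (blockPerm n σ) (blockPerm n σ)) =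
      (p.PRic N Z).submatrix (blockPerm n σ) (blockPerm n σ) := by
  unfold Params.PRic
  rw [weight_submatrix, Matrix.inv_submatrix_equiv]
  simp only [Matrix.submatrix_sub, Pi.sub_apply,
    ← Matrix.submatrix_mul_equiv _ _ _ (blockPerm n σ) _,
    ← Matrix.submatrix_mul_equiv _ _ _ (blockPerm n₁ σ) _,
    ← Matrix.transpose_submatrix, bigA_submatrix, bigQ_submatrix, bigBhat_submatrix]

/-- Relabelling the agents maps solutions of (ODE-P) to solutions. -/
lemma isSolP_submatrix {P : ℝ → Matrix (Fin N × Fin n) (Fin N × Fin n) ℝ}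
    (hP : p.IsSolP N P) :
    p.IsSolP N fun t => (P t).submatrix (blockPerm n σ) (blockPerm n σ) := by
  obtain ⟨hs, hpd, hT, hd⟩ := hP
  refine ⟨fun t ht => (hs t ht).submatrix _, fun t ht => ?_, ?_, fun t ht x y => ?_⟩
  · rw [weight_submatrix]
    exact (hpd t ht).submatrix (blockPerm n₁ σ).injective
  · simp only [hT, bigQf_submatrix]
  · rw [PRic_submatrix]
    exact hd t ht _ _

end Equivariance

section Uniqueness

open scoped Matrix.Norms.Operator

lemma hasDerivWithinAt_matrix {a b : Type*} [Fintype a] [Fintype b]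
    {F : ℝ → Matrix a b ℝ} {F' : Matrix a b ℝ} {s : Set ℝ} {t : ℝ}
    (h : ∀ i j, HasDerivWithinAt (fun u => F u i j) (F' i j) s t) :
    HasDerivWithinAt F F' s t := by
  classical
  have key : ∀ M : Matrix a b ℝ, M = ∑ i, ∑ j, M i j • Matrix.single i j (1 : ℝ) := fun M => by
    conv_lhs => rw [Matrix.matrix_eq_sum_single M]
    simp [Matrix.smul_single]
  rw [key F', funext fun u => key (F u)]
  exact HasDerivWithinAt.fun_sum fun i _ => HasDerivWithinAt.fun_sum fun j _ =>
    (h i j).smul_const _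

lemma continuousOn_matrix_inv {a : Type*} [Fintype a] [DecidableEq a] {s : Set ℝ}
    {F : ℝ → Matrix a a ℝ} (hF : ContinuousOn F s) (hu : ∀ t ∈ s, IsUnit (F t)) :
    ContinuousOn (fun t => (F t)⁻¹) s := by
  intro t ht
  obtain ⟨u, hu⟩ := hu t ht
  have h := NormedRing.inverse_continuousAt u
  rw [hu] at h
  simp only [Matrix.nonsing_inv_eq_ringInverse]
  exact h.comp_continuousWithinAt (hF t ht)

variable {n n₁ : ℕ} (p : Params n n₁) {N : ℕ}

/-- `𝓜₂` as a linear map. -/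
noncomputable def M2Lin (N : ℕ) : Matrix (Fin N × Fin n) (Fin N × Fin n) ℝ →ₗ[ℝ]
    Matrix (Fin N × Fin n₁) (Fin N × Fin n₁) ℝ where
  toFun := p.M2 N
  map_add' X Y := by
    simp only [Params.M2, Matrix.mul_add, Matrix.add_mul, Finset.sum_add_distrib, smul_add]
    abel
  map_smul' c X := by
    simp only [Params.M2, Matrix.mul_smul, Matrix.smul_mul, ← Finset.smul_sum, smul_add,
      RingHom.id_apply, smul_comm c]

/-- The state-space weight `𝐁̂ (𝐑 + 2𝓜₂(Z))⁻¹ 𝐁̂ᵀ` of the quadratic term. -/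
noncomputable def quadWeight (N : ℕ) (Z : Matrix (Fin N × Fin n) (Fin N × Fin n) ℝ) :
    Matrix (Fin N × Fin n) (Fin N × Fin n) ℝ :=
  p.bigBhat N * (p.bigR N + (2 : ℝ) • p.M2 N Z)⁻¹ * (p.bigBhat N)ᵀ

lemma PRic_sub_PRic {X Y : Matrix (Fin N × Fin n) (Fin N × Fin n) ℝ} :
    p.PRic N X - p.PRic N Y =
      (X - Y) * quadWeight p N X * X + Y * (quadWeight p N X - quadWeight p N Y) * X
        + Y * quadWeight p N Y * (X - Y) - (X - Y) * p.bigA N - (p.bigA N)ᵀ * (X - Y) := by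
  unfold Params.PRic quadWeight
  simp only [Matrix.mul_sub, Matrix.sub_mul, Matrix.mul_assoc]
  abel

lemma exists_norm_quadWeight_sub_le (N : ℕ) (C : ℝ) : ∃ L : ℝ, 0 ≤ L ∧
    ∀ X Y : Matrix (Fin N × Fin n) (Fin N × Fin n) ℝ,
      IsUnit (p.bigR N + (2 : ℝ) • p.M2 N X) → IsUnit (p.bigR N + (2 : ℝ) • p.M2 N Y) →
      ‖(p.bigR N + (2 : ℝ) • p.M2 N X)⁻¹‖ ≤ C → ‖(p.bigR N + (2 : ℝ) • p.M2 N Y)⁻¹‖ ≤ C →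
      ‖quadWeight p N X - quadWeight p N Y‖ ≤ L * ‖X - Y‖ := by
  obtain ⟨m, hm, hM⟩ := SemilinearMapClass.bound_of_continuous (M2Lin p N)
    (LinearMap.continuous_of_finiteDimensional _)
  refine ⟨‖p.bigBhat N‖ * (|C| * (2 * m) * |C|) * ‖(p.bigBhat N)ᵀ‖, by positivity,
    fun X Y hX hY hCX hCY => ?_⟩
  set U := p.bigR N + (2 : ℝ) • p.M2 N X
  set V := p.bigR N + (2 : ℝ) • p.M2 N Y
  have hVU : V - U = (2 : ℝ) • M2Lin p N (Y - X) := by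
    rw [map_sub, smul_sub]
    exact add_sub_add_left_eq_sub _ _ _
  have hinv : U⁻¹ - V⁻¹ = U⁻¹ * (V - U) * V⁻¹ := by
    rw [Matrix.isUnit_iff_isUnit_det] at hX hY
    rw [Matrix.mul_sub, Matrix.sub_mul, Matrix.mul_nonsing_inv_cancel_right _ _ hY,
      Matrix.nonsing_inv_mul _ hX, Matrix.one_mul]
  have hq : quadWeight p N X - quadWeight p N Y =
      p.bigBhat N * (U⁻¹ * (V - U) * V⁻¹) * (p.bigBhat N)ᵀ := by
    rw [← hinv, Matrix.mul_sub, Matrix.sub_mul]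
    rfl
  have hd : ‖V - U‖ ≤ 2 * m * ‖X - Y‖ := by
    rw [hVU, norm_smul, norm_sub_rev X Y, mul_assoc]
    simpa using hM (Y - X)
  calc ‖quadWeight p N X - quadWeight p N Y‖
      ≤ ‖p.bigBhat N‖ * (‖U⁻¹‖ * ‖V - U‖ * ‖V⁻¹‖) * ‖(p.bigBhat N)ᵀ‖ := by
        rw [hq]
        refine (Matrix.linfty_opNorm_mul _ _).trans ?_
        gcongr
        refine (Matrix.linfty_opNorm_mul _ _).trans ?_
        gcongr
        refine (Matrix.linfty_opNorm_mul _ _).trans ?_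
        gcongr
        exact Matrix.linfty_opNorm_mul _ _
    _ ≤ ‖p.bigBhat N‖ * (|C| * (2 * m * ‖X - Y‖) * |C|) * ‖(p.bigBhat N)ᵀ‖ := by
        gcongr
        · exact hCX.trans (le_abs_self C)
        · exact hCY.trans (le_abs_self C)
    _ = _ := by ring

/-- The Riccati field is Lipschitz between points where the state and the inverse weight are
bounded. -/
lemma exists_norm_PRic_sub_le (N : ℕ) (C : ℝ) : ∃ K : NNReal,
    ∀ X Y : Matrix (Fin N × Fin n) (Fin N × Fin n) ℝ,
      IsUnit (p.bigR N + (2 : ℝ) • p.M2 N X) → IsUnit (p.bigR N + (2 : ℝ) • p.M2 N Y) →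
      ‖(p.bigR N + (2 : ℝ) • p.M2 N X)⁻¹‖ ≤ C → ‖(p.bigR N + (2 : ℝ) • p.M2 N Y)⁻¹‖ ≤ C →
      ‖X‖ ≤ C → ‖Y‖ ≤ C → ‖p.PRic N X - p.PRic N Y‖ ≤ K * ‖X - Y‖ := by
  obtain ⟨L, hL, hLip⟩ := exists_norm_quadWeight_sub_le p N C
  set S : ℝ := ‖p.bigBhat N‖ * |C| * ‖(p.bigBhat N)ᵀ‖
  refine ⟨(S * |C| + |C| * L * |C| + |C| * S + ‖p.bigA N‖ + ‖(p.bigA N)ᵀ‖).toNNReal,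
    fun X Y hX hY hCX hCY hX' hY' => ?_⟩
  have hS : ∀ Z, ‖(p.bigR N + (2 : ℝ) • p.M2 N Z)⁻¹‖ ≤ C → ‖quadWeight p N Z‖ ≤ S := by
    intro Z hZ
    refine (Matrix.linfty_opNorm_mul _ _).trans ?_
    refine mul_le_mul_of_nonneg_right ?_ (norm_nonneg _)
    refine (Matrix.linfty_opNorm_mul _ _).trans ?_
    exact mul_le_mul_of_nonneg_left (hZ.trans (le_abs_self C)) (norm_nonneg _)
  have hSX := hS X hCX
  have hSY := hS Y hCY
  have hq := hLip X Y hX hY hCX hCY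
  replace hX' := hX'.trans (le_abs_self C)
  replace hY' := hY'.trans (le_abs_self C)
  have hS0 : 0 ≤ S := by positivity
  rw [PRic_sub_PRic]
  calc _ ≤ ‖X - Y‖ * ‖quadWeight p N X‖ * ‖X‖
        + ‖Y‖ * ‖quadWeight p N X - quadWeight p N Y‖ * ‖X‖
        + ‖Y‖ * ‖quadWeight p N Y‖ * ‖X - Y‖ + ‖X - Y‖ * ‖p.bigA N‖
        + ‖(p.bigA N)ᵀ‖ * ‖X - Y‖ := by
        refine norm_sub_le_of_le (norm_sub_le_of_le (norm_add_le_of_le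
          (norm_add_le_of_le ?_ ?_) ?_) (norm_mul_le _ _)) (norm_mul_le _ _)
        all_goals exact norm_mul₃_le
    _ ≤ ‖X - Y‖ * S * |C| + |C| * (L * ‖X - Y‖) * |C| + |C| * S * ‖X - Y‖
        + ‖X - Y‖ * ‖p.bigA N‖ + ‖(p.bigA N)ᵀ‖ * ‖X - Y‖ := by
        gcongr
    _ = _ := by
        rw [Real.coe_toNNReal _ (by positivity)]
        ring

lemma isSolP_continuousOn {P : ℝ → Matrix (Fin N × Fin n) (Fin N × Fin n) ℝ}
    (hP : p.IsSolP N P) : ContinuousOn P (Icc 0 p.T) := fun t ht =>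
  (hasDerivWithinAt_matrix (hP.2.2.2 t ht)).continuousWithinAt

lemma isSolP_exists_bound {P : ℝ → Matrix (Fin N × Fin n) (Fin N × Fin n) ℝ}
    (hP : p.IsSolP N P) : ∃ C : ℝ, ∀ t ∈ Icc 0 p.T,
      ‖(p.bigR N + (2 : ℝ) • p.M2 N (P t))⁻¹‖ ≤ C ∧ ‖P t‖ ≤ C := by
  have hc := isSolP_continuousOn p hP
  have hM : ContinuousOn (fun t => p.M2 N (P t)) (Icc 0 p.T) :=
    (LinearMap.continuous_of_finiteDimensional (M2Lin p N)).comp_continuousOn hc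
  have hw : ContinuousOn (fun t => (p.bigR N + (2 : ℝ) • p.M2 N (P t))⁻¹) (Icc 0 p.T) :=
    continuousOn_matrix_inv (continuousOn_const.add (hM.const_smul (2 : ℝ)))
      fun t ht => (hP.2.1 t ht).isUnit
  obtain ⟨C₁, h₁⟩ := isCompact_Icc.exists_bound_of_continuousOn hw
  obtain ⟨C₂, h₂⟩ := isCompact_Icc.exists_bound_of_continuousOn hc
  exact ⟨max C₁ C₂, fun t ht => ⟨(h₁ t ht).trans (le_max_left _ _),
    (h₂ t ht).trans (le_max_right _ _)⟩⟩

/-- Solutions of (ODE-P) are unique. -/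
theorem isSolP_unique {P P' : ℝ → Matrix (Fin N × Fin n) (Fin N × Fin n) ℝ}
    (hP : p.IsSolP N P) (hP' : p.IsSolP N P') : EqOn P P' (Icc 0 p.T) := by
  obtain ⟨C, hC⟩ := isSolP_exists_bound p hP
  obtain ⟨C', hC'⟩ := isSolP_exists_bound p hP'
  obtain ⟨K, hK⟩ := exists_norm_PRic_sub_le p N (max C C')
  have hder : ∀ {X : ℝ → Matrix (Fin N × Fin n) (Fin N × Fin n) ℝ}, p.IsSolP N X →
      ∀ t ∈ Ioc 0 p.T, HasDerivWithinAt X (p.PRic N (X t)) (Iic t) t := fun hX t ht =>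
    ((hasDerivWithinAt_matrix (hX.2.2.2 t (Ioc_subset_Icc_self ht))).mono
      (Icc_subset_Icc_right ht.2)).mono_of_mem_nhdsWithin (Icc_mem_nhdsLE ht.1)
  refine ODE_solution_unique_of_mem_Icc_left (v := fun _ => p.PRic N) (K := K)
    (s := fun t => {P t, P' t}) (fun t ht => ?_) (isSolP_continuousOn p hP) (hder hP)
    (fun t _ => mem_insert _ _) (isSolP_continuousOn p hP') (hder hP')
    (fun t _ => mem_insert_of_mem _ rfl) (hP.2.2.1.trans hP'.2.2.1.symm)
  have ht' := Ioc_subset_Icc_self ht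
  have hmem : ∀ X ∈ ({P t, P' t} : Set _), IsUnit (p.bigR N + (2 : ℝ) • p.M2 N X) ∧
      ‖(p.bigR N + (2 : ℝ) • p.M2 N X)⁻¹‖ ≤ max C C' ∧ ‖X‖ ≤ max C C' := by
    rintro X (rfl | rfl)
    · exact ⟨(hP.2.1 t ht').isUnit, (hC t ht').1.trans (le_max_left _ _),
        (hC t ht').2.trans (le_max_left _ _)⟩
    · exact ⟨(hP'.2.1 t ht').isUnit, (hC' t ht').1.trans (le_max_right _ _),
        (hC' t ht').2.trans (le_max_right _ _)⟩
  refine LipschitzOnWith.of_dist_le_mul fun X hX Y hY => ?_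
  obtain ⟨h1, h2, h3⟩ := hmem X hX
  obtain ⟨h4, h5, h6⟩ := hmem Y hY
  simpa only [dist_eq_norm] using hK X Y h1 h4 h2 h5 h3 h6

end Uniqueness

/-- A solution of (ODE-P) is invariant under relabelling of the agents. -/
lemma isSolP_apply_perm {n n₁ N : ℕ} (p : Params n n₁)
    {P : ℝ → Matrix (Fin N × Fin n) (Fin N × Fin n) ℝ} (hP : p.IsSolP N P)
    {t : ℝ} (ht : t ∈ Icc 0 p.T) (σ : Equiv.Perm (Fin N)) (i j : Fin N) (k l : Fin n) :
    P t (i, k) (j, l) = P t (σ i, k) (σ j, l) :=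
  congrFun (congrFun (isSolP_unique p hP (isSolP_submatrix p σ hP) ht) (i, k)) (j, l)

lemma exists_perm_map_pair {α : Type*} [DecidableEq α] {i j i' j' : α} (h : i ≠ j)
    (h' : i' ≠ j') : ∃ σ : Equiv.Perm α, σ i = i' ∧ σ j = j' := by
  have hne : Equiv.swap i i' j ≠ i' := fun e =>
    h ((Equiv.swap i i').injective (e.trans (Equiv.swap_apply_left i i').symm)).symm
  refine ⟨(Equiv.swap i i').trans (Equiv.swap (Equiv.swap i i' j) j'), ?_, ?_⟩
  · simp [Equiv.swap_apply_of_ne_of_ne hne.symm h']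
  · simp

/-- any solution of (ODE-P) has common diagonal blocks and common
off-diagonal blocks, both symmetric. -/
theorem solP_two_block_structure {n n₁ : ℕ} (p : Params n n₁) (hp : p.Standing)
    (N : ℕ) (hN : 1 ≤ N)
    (P : ℝ → Matrix (Fin N × Fin n) (Fin N × Fin n) ℝ) (hP : p.IsSolP N P) :
    ∃ Pi1 Pi2 : ℝ → Matrix (Fin n) (Fin n) ℝ,
      ∀ t ∈ Icc (0 : ℝ) p.T,
        (Pi1 t).IsSymm ∧ (Pi2 t).IsSymm ∧
        (∀ (i : Fin N) (k l : Fin n), P t (i, k) (i, l) = Pi1 t k l) ∧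
        (∀ (i j : Fin N), i ≠ j → ∀ (k l : Fin n), P t (i, k) (j, l) = Pi2 t k l) := by
  have hdiag : ∀ t ∈ Icc (0 : ℝ) p.T, ∀ (i i' : Fin N) (k l : Fin n),
      P t (i, k) (i, l) = P t (i', k) (i', l) := fun t ht i i' k l => by
    simpa using isSolP_apply_perm p hP ht (Equiv.swap i i') i i k l
  have hoff : ∀ t ∈ Icc (0 : ℝ) p.T, ∀ (i j i' j' : Fin N), i ≠ j → i' ≠ j' →
      ∀ k l : Fin n, P t (i, k) (j, l) = P t (i', k) (j', l) := by
    intro t ht i j i' j' h h' k l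
    obtain ⟨σ, rfl, rfl⟩ := exists_perm_map_pair h h'
    exact isSolP_apply_perm p hP ht σ i j k l
  have hsymm : ∀ t ∈ Icc (0 : ℝ) p.T, ∀ x y, P t x y = P t y x := fun t ht x y =>
    (hP.1 t ht).apply y x
  let i₀ : Fin N := ⟨0, hN⟩
  by_cases hoff_ex : ∃ a b : Fin N, a ≠ b
  · obtain ⟨a, b, hab⟩ := hoff_ex
    refine ⟨fun t => Matrix.of fun k l => P t (i₀, k) (i₀, l),
      fun t => Matrix.of fun k l => P t (a, k) (b, l), fun t ht => ⟨?_, ?_, ?_, ?_⟩⟩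
    · exact Matrix.IsSymm.ext fun k l => hsymm t ht _ _
    · exact Matrix.IsSymm.ext fun k l =>
        (hsymm t ht _ _).trans (hoff t ht b a a b hab.symm hab k l)
    · exact fun i k l => hdiag t ht i i₀ k l
    · exact fun i j hij k l => hoff t ht i j a b hij hab k l
  · push Not at hoff_ex
    refine ⟨fun t => Matrix.of fun k l => P t (i₀, k) (i₀, l), 0, fun t ht => ⟨?_, ?_, ?_, ?_⟩⟩
    · exact Matrix.IsSymm.ext fun k l => hsymm t ht _ _
    · exact Matrix.isSymm_zero
    · exact fun i k l => hdiag t ht i i₀ k l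
    · exact fun i j hij => absurd (hoff_ex i j) hij

end LQ
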